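/- In the case β = α+1, the end-to-end correlation function of the Hahn spin chain is f_{2m+1,0}(t) = -2i(-1)^m ((α+1)_{m+1}/(2α+2)_{m+1}) · Σ_{j=0}^{m} ((-m)_j(2α+2)_j)/(j!(2α+m+3)_j) · sin(2t(α+j+1)). -/

import Mathlib

open Finset Matrix

/-- Pochhammer symbol `(a)_k = a(a+1)⋯(a+k-1)`. -/
noncomputable def poch (a : ℝ) (k : ℕ) : ℝ := ∏ i ∈ Finset.range k, (a + i)

/-- The Hahn polynomial `Q_n(x;α,β,m)` as a terminating ₃F₂ series. -/
noncomputable def hahnQ (n : ℕ) (x α β : ℝ) (m : ℕ) : ℝ :=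
  ∑ k ∈ Finset.range (n + 1),
    poch (-(n : ℝ)) k * poch ((n : ℝ) + α + β + 1) k * poch (-x) k /
      ((k.factorial : ℝ) * poch (α + 1) k * poch (-(m : ℝ)) k)

/-- The Hahn weight `w(x;α,β,m) = C(α+x,x) C(m+β-x,m-x)`. -/
noncomputable def hahnW (x : ℕ) (α β : ℝ) (m : ℕ) : ℝ :=
  (poch (α + 1) x / (x.factorial : ℝ)) * (poch (β + 1) (m - x) / ((m - x).factorial : ℝ))

/-- The squared norm `h_n(α,β,m)` of the Hahn polynomials. -/
noncomputable def hahnH (n : ℕ) (α β : ℝ) (m : ℕ) : ℝ :=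
  ((-1 : ℝ) ^ n * poch ((n : ℝ) + α + β + 1) (m + 1) * poch (β + 1) n * (n.factorial : ℝ)) /
    ((2 * (n : ℝ) + α + β + 1) * poch (α + 1) n * poch (-(m : ℝ)) n * (m.factorial : ℝ))

/-- Orthonormal Hahn function `Q̃_n(x;α,β,m)`. -/
noncomputable def hahnQt (n x : ℕ) (α β : ℝ) (m : ℕ) : ℝ :=
  Real.sqrt (hahnW x α β m) * hahnQ n (x : ℝ) α β m / Real.sqrt (hahnH n α β m)

/-- The matrix `U` of eigenvectors, built from Hahn polynomials with
parameters `(α,β)` (even rows) and `(α+1,β-1)` (odd rows). -/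
noncomputable def hahnU (α β : ℝ) (m : ℕ) : Matrix (Fin (2 * m + 2)) (Fin (2 * m + 2)) ℝ :=
  Matrix.of fun r c =>
    let i : ℕ := (r : ℕ) / 2
    let j : ℕ := if (c : ℕ) ≤ m then m - (c : ℕ) else (c : ℕ) - m - 1
    if (r : ℕ) % 2 = 0 then
      ((-1 : ℝ) ^ i / Real.sqrt 2) * hahnQt j i α β m
    else
      (if (c : ℕ) ≤ m then (-1 : ℝ) else 1) * ((-1 : ℝ) ^ i / Real.sqrt 2)
        * hahnQt j i (α + 1) (β - 1) m

/-- The spin chain couplings `J_k`. -/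
noncomputable def hahnJ (α β : ℝ) (m : ℕ) (k : ℕ) : ℝ :=
  if k % 2 = 1 then Real.sqrt (((k : ℝ) + 1) * ((2 * m + 1 : ℝ) - k))
  else Real.sqrt (((k : ℝ) + 2 * α + 2) * ((2 * m : ℝ) + 2 * β - k))

/-- The tridiagonal single-excitation interaction matrix `M`. -/
noncomputable def hahnM (α β : ℝ) (m : ℕ) : Matrix (Fin (2 * m + 2)) (Fin (2 * m + 2)) ℝ :=
  Matrix.of fun r c =>
    if (r : ℕ) + 1 = (c : ℕ) then hahnJ α β m r
    else if (c : ℕ) + 1 = (r : ℕ) then hahnJ α β m c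
    else 0

/-- The eigenvalues `ε_{m-k} = -2√((α+k+1)(β+k))`, `ε_{m+k+1} = 2√((α+k+1)(β+k))`. -/
noncomputable def hahnEps (α β : ℝ) (m : ℕ) (c : Fin (2 * m + 2)) : ℝ :=
  if (c : ℕ) ≤ m then
    -2 * Real.sqrt ((α + (m - (c : ℕ) : ℕ) + 1) * (β + (m - (c : ℕ) : ℕ)))
  else
    2 * Real.sqrt ((α + ((c : ℕ) - m - 1 : ℕ) + 1) * (β + ((c : ℕ) - m - 1 : ℕ)))

/-- The correlation function `f_{r,s}(t)`. -/
noncomputable def hahnCorr (α β : ℝ) (m : ℕ) (r s : Fin (2 * m + 2)) (t : ℝ) : ℂ :=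
  ∑ j : Fin (2 * m + 2),
    ((hahnU α β m r j * hahnU α β m s j : ℝ) : ℂ)
      * Complex.exp (-Complex.I * t * (hahnEps α β m j : ℝ))

lemma poch_zero (a : ℝ) : poch a 0 = 1 := by simp [poch]

lemma poch_succ (a : ℝ) (k : ℕ) : poch a (k + 1) = poch a k * (a + k) := by
  simp [poch, Finset.prod_range_succ]

lemma poch_succ_left (a : ℝ) (k : ℕ) : poch a (k + 1) = a * poch (a + 1) k := by
  unfold poch
  rw [Finset.prod_range_succ', mul_comm]
  simp only [Nat.cast_zero, add_zero]
  congr 1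
  apply Finset.prod_congr rfl
  intro i _
  push_cast
  ring

lemma poch_add (a : ℝ) (k l : ℕ) : poch a (k + l) = poch a k * poch (a + k) l := by
  unfold poch
  rw [Finset.prod_range_add]
  congr 1
  apply Finset.prod_congr rfl
  intro i _
  push_cast
  ring

lemma poch_pos {a : ℝ} (ha : 0 < a) (k : ℕ) : 0 < poch a k := by
  unfold poch
  exact Finset.prod_pos fun i _ => by positivity

lemma poch_neg_nat (n k : ℕ) :
    poch (-(n : ℝ)) k = (-1 : ℝ) ^ k * (n.choose k : ℝ) * (k.factorial : ℝ) := by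
  induction k with
  | zero => simp [poch]
  | succ k ih =>
    rw [poch_succ, ih, Nat.factorial_succ]
    rcases Nat.lt_or_ge n k with h | h
    · rw [Nat.choose_eq_zero_of_lt h, Nat.choose_eq_zero_of_lt (by omega)]
      simp
    · have := Nat.choose_succ_right_eq n k
      have h2 : (n.choose (k + 1) : ℝ) * (k + 1) = n.choose k * ((n : ℝ) - k) := by
        rw [← Nat.cast_sub h]
        exact_mod_cast this
      push_cast
      linear_combination ((-1 : ℝ) ^ k * (k.factorial : ℝ)) * h2

lemma vander (n : ℕ) : ∀ b c : ℝ, 0 < c →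
    ∑ k ∈ Finset.range (n + 1), (-1 : ℝ) ^ k * (n.choose k : ℝ) * (poch b k / poch c k)
      = poch (c - b) n / poch c n := by
  induction n with
  | zero => intro b c _; simp [poch]
  | succ n ih =>
    intro b c hc
    have e1 := ih b c hc
    have e2 := ih (b + 1) (c + 1) (by linarith)
    have hcn := (poch_pos hc n).ne'
    have hcn1 := (poch_pos (show 0 < c + 1 by linarith) n).ne'
    have key : ∑ k ∈ Finset.range (n + 1 + 1),
        (-1 : ℝ) ^ k * ((n + 1).choose k : ℝ) * (poch b k / poch c k)
        = (∑ k ∈ Finset.range (n + 1), (-1 : ℝ) ^ k * (n.choose k : ℝ) * (poch b k / poch c k))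
          - b / c * ∑ k ∈ Finset.range (n + 1),
            (-1 : ℝ) ^ k * (n.choose k : ℝ) * (poch (b + 1) k / poch (c + 1) k) := by
      have e3 : (∑ k ∈ Finset.range (n + 1),
          (-1 : ℝ) ^ k * (n.choose k : ℝ) * (poch b k / poch c k))
          = ∑ k ∈ Finset.range (n + 1 + 1),
          (-1 : ℝ) ^ k * (n.choose k : ℝ) * (poch b k / poch c k) := by
        rw [Finset.sum_range_succ _ (n + 1)]
        simp
      rw [e3, Finset.sum_range_succ', Finset.sum_range_succ' _ (n + 1), Finset.mul_sum,
        add_sub_right_comm, ← Finset.sum_sub_distrib]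
      congr 1
      · apply Finset.sum_congr rfl
        intro k _
        rw [Nat.choose_succ_succ, poch_succ_left, poch_succ_left, mul_div_mul_comm]
        push_cast
        ring
      · simp
    rw [key, e1, e2, show c + 1 - (b + 1) = c - b by ring]
    have h1 : c * poch (c + 1) n = poch c n * (c + n) := by
      rw [← poch_succ_left, poch_succ]
    rw [poch_succ (c - b), poch_succ c]
    have hcp : c + (n : ℝ) ≠ 0 := by positivity
    have h2 : poch (c + 1) n = poch c n * (c + n) / c := by
      field_simp
      linarith
    rw [h2]
    field_simp
    ring

lemma poch_reflect (a : ℝ) (j : ℕ) : poch (-(j : ℝ) - a) j = (-1 : ℝ) ^ j * poch (a + 1) j := by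
  unfold poch
  rw [← Finset.prod_range_reflect (fun i : ℕ => a + 1 + (i : ℝ)), ← Finset.card_range j,
    ← Finset.prod_const, Finset.card_range, ← Finset.prod_mul_distrib]
  apply Finset.prod_congr rfl
  intro i hi
  have hi' : i + 1 ≤ j := Finset.mem_range.mp hi
  rw [show j - 1 - i = j - (i + 1) by omega, Nat.cast_sub hi']
  push_cast
  ring

lemma hahnQ_zero (n : ℕ) (a b : ℝ) (m : ℕ) : hahnQ n 0 a b m = 1 := by
  unfold hahnQ
  rw [Finset.sum_range_succ', Finset.sum_eq_zero]
  · simp [poch]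
  · intro k _
    rw [poch_succ_left (-0 : ℝ)]
    simp

lemma hahnQ_end (n : ℕ) (a b : ℝ) (m : ℕ) (ha : 0 < a + 1) (hn : n ≤ m) :
    hahnQ n (m : ℝ) a b m = (-1 : ℝ) ^ n * poch (b + 1) n / poch (a + 1) n := by
  have h := vander n ((n : ℝ) + a + b + 1) (a + 1) ha
  rw [show a + 1 - ((n : ℝ) + a + b + 1) = -(n : ℝ) - b by ring, poch_reflect] at h
  rw [← h]
  unfold hahnQ
  apply Finset.sum_congr rfl
  intro k hk
  have hk' : k ≤ m := by have := Finset.mem_range.mp hk; omega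
  have h0 : poch (-(m : ℝ)) k ≠ 0 := by
    rw [poch_neg_nat]
    have : (m.choose k : ℝ) ≠ 0 := by exact_mod_cast (Nat.choose_pos hk').ne'
    have := Nat.factorial_ne_zero k
    positivity
  have h1 := (poch_pos ha k).ne'
  have h2 : (k.factorial : ℝ) ≠ 0 := by exact_mod_cast Nat.factorial_ne_zero k
  rw [poch_neg_nat n k]
  field_simp

lemma hahn_prod (j m : ℕ) (α : ℝ) (hα : α > -1) (hj : j ≤ m) :
    hahnQt j m (α + 1) α m * hahnQt j 0 α (α + 1) m
      = 2 * (poch (α + 1) (m + 1) / poch (2 * α + 2) (m + 1))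
        * (poch (-(m : ℝ)) j * poch (2 * α + 2) j
                  / ((j.factorial : ℝ) * poch (2 * α + m + 3) j)) := by
  have p1 : 0 < α + 1 := by linarith
  have p2 : 0 < α + 1 + 1 := by linarith
  have p3 : 0 < 2 * α + 2 := by linarith
  have p4 : 0 < 2 * α + 2 + j := by positivity
  have p5 : 0 < α + 1 + j := by positivity
  have p6 : 0 < 2 * α + m + 3 := by have : (0:ℝ) ≤ m := Nat.cast_nonneg m
                                    linarith
  have q1 := poch_pos p1 j
  have q2 := poch_pos p2 j
  have q2m := poch_pos p2 m
  have q3 := poch_pos p4 (m + 1)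
  have q4 := poch_pos p3 (m + 1)
  have q5 := poch_pos p3 j
  have q6 := poch_pos p6 j
  have hjf : (0:ℝ) < j.factorial := by exact_mod_cast Nat.factorial_pos j
  have hmf : (0:ℝ) < m.factorial := by exact_mod_cast Nat.factorial_pos m
  have hch : (0:ℝ) < m.choose j := by exact_mod_cast Nat.choose_pos hj
  have hsq : ((-1 : ℝ) ^ j) * (-1) ^ j = 1 := by rw [← mul_pow]; simp
  have hs0 : ((-1 : ℝ) ^ j) ≠ 0 := by positivity
  -- the common constant
  set C : ℝ := poch (2 * α + 2 + j) (m + 1) / (2 * (α + 1 + j) * m.choose j * m.factorial) with hC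
  have hCpos : 0 < C := by positivity
  have H1 : hahnH j (α + 1) α m = C * (poch (α + 1) j / poch (α + 1 + 1) j) := by
    unfold hahnH
    rw [poch_neg_nat, hC, show (j : ℝ) + (α + 1) + α + 1 = 2 * α + 2 + j by ring,
      show 2 * (j : ℝ) + (α + 1) + α + 1 = 2 * (α + 1 + j) by ring]
    field_simp
  have H2 : hahnH j α (α + 1) m = C * (poch (α + 1 + 1) j / poch (α + 1) j) := by
    unfold hahnH
    rw [poch_neg_nat, hC, show (j : ℝ) + α + (α + 1) + 1 = 2 * α + 2 + j by ring,
      show 2 * (j : ℝ) + α + (α + 1) + 1 = 2 * (α + 1 + j) by ring]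
    field_simp
  have W1 : hahnW m (α + 1) α m = poch (α + 1 + 1) m / m.factorial := by
    simp [hahnW, poch_zero]
  have W2 : hahnW 0 α (α + 1) m = poch (α + 1 + 1) m / m.factorial := by
    simp [hahnW, poch_zero]
  have hH : Real.sqrt (hahnH j (α + 1) α m) * Real.sqrt (hahnH j α (α + 1) m) = C := by
    rw [← Real.sqrt_mul (by rw [H1]; positivity), H1, H2]
    rw [show C * (poch (α + 1) j / poch (α + 1 + 1) j) * (C * (poch (α + 1 + 1) j / poch (α + 1) j))
      = C * C by field_simp]
    exact Real.sqrt_mul_self hCpos.le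
  have hW : Real.sqrt (hahnW m (α + 1) α m) * Real.sqrt (hahnW 0 α (α + 1) m)
      = poch (α + 1 + 1) m / m.factorial := by
    rw [W1, W2]
    exact Real.mul_self_sqrt (by positivity)
  have e1 : (α + 1) * poch (α + 1 + 1) j = poch (α + 1) j * (α + 1 + j) := by
    rw [← poch_succ_left, poch_succ]
  have e2 : poch (2 * α + 2) j * poch (2 * α + 2 + j) (m + 1)
      = poch (2 * α + 2) (m + 1) * poch (2 * α + m + 3) j := by
    have := poch_add (2 * α + 2) (m + 1) j
    rw [add_comm (m + 1) j, poch_add] at this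
    rw [this]
    congr 2
    push_cast
    ring
  unfold hahnQt
  rw [div_mul_div_comm, hH, Nat.cast_zero, hahnQ_zero, hahnQ_end j _ _ m p2 hj, mul_one,
    mul_right_comm, hW, poch_neg_nat, poch_succ_left (α + 1) m, hC]
  have e3 : poch (α + 1) j = (α + 1) * poch (α + 1 + 1) j / (α + 1 + j) := by
    rw [e1]; field_simp
  have e4 : poch (2 * α + 2 + j) (m + 1) =
      poch (2 * α + 2) (m + 1) * poch (2 * α + m + 3) j / poch (2 * α + 2) j := by
    exact eq_div_of_mul_eq q5.ne' (by rw [mul_comm, e2])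
  rw [e3, e4]
  field_simp

theorem hahn_end_to_end_correlation_beta_eq_alpha_add_one
    (m : ℕ) (α β : ℝ) (hα : α > -1) (hβ : β = α + 1) (t : ℝ) :
    hahnCorr α β m ⟨2 * m + 1, by omega⟩ ⟨0, by omega⟩ t
      = -2 * Complex.I * (-1 : ℂ) ^ m
          * ((poch (α + 1) (m + 1) / poch (2 * α + 2) (m + 1) : ℝ) : ℂ)
          * ((∑ j ∈ Finset.range (m + 1),
              (poch (-(m : ℝ)) j * poch (2 * α + 2) j
                  / ((j.factorial : ℝ) * poch (2 * α + m + 3) j))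
                * Real.sin (2 * t * (α + j + 1)) : ℝ) : ℂ) := by
  subst hβ
  set P : ℕ → ℝ := fun j => hahnQt j m (α + 1) α m * hahnQt j 0 α (α + 1) m with hP
  set G : ℝ → ℕ → ℂ := fun s j =>
    ((s * ((-1 : ℝ) ^ m / 2) * P j : ℝ) : ℂ)
      * Complex.exp (-Complex.I * t * ((s * (2 * (α + j + 1)) : ℝ) : ℂ)) with hG
  have heps : ∀ k : ℕ, Real.sqrt ((α + k + 1) * (α + 1 + k)) = α + k + 1 := by
    intro k
    rw [show α + 1 + (k : ℝ) = α + k + 1 by ring]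
    apply Real.sqrt_mul_self
    have : (0:ℝ) ≤ k := Nat.cast_nonneg k
    linarith
  have hsqrt : Real.sqrt 2 * Real.sqrt 2 = 2 := Real.mul_self_sqrt (by norm_num)
  have hs : Real.sqrt 2 ≠ 0 := by positivity
  have h1 : hahnCorr α (α + 1) m ⟨2 * m + 1, by omega⟩ ⟨0, by omega⟩ t
      = ∑ c : Fin (2 * m + 2),
        (fun c : ℕ => if c ≤ m then G (-1) (m - c) else G 1 (c - m - 1)) (c : ℕ) := by
    unfold hahnCorr
    apply Finset.sum_congr rfl
    intro c _
    have d1 : (2 * m + 1) / 2 = m := by omega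
    have d2 : (2 * m + 1) % 2 = 1 := by omega
    by_cases hc : (c : ℕ) ≤ m
    · simp only [hahnU, hahnEps, Matrix.of_apply, d1, d2, hc, if_true, hG, hP, heps]
      congr 1
      · refine congrArg Complex.ofReal ?_
        simp only [Nat.zero_mod, Nat.zero_div, if_true, one_ne_zero, if_false, pow_zero,
          add_sub_cancel_right]
        field_simp
        rw [show Real.sqrt 2 ^ 2 = 2 by rw [sq, hsqrt]]
        ring
      · congr 3
        ring
    · simp only [hahnU, hahnEps, Matrix.of_apply, d1, d2, hc, if_false, hG, hP, heps]
      congr 1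
      · refine congrArg Complex.ofReal ?_
        simp only [Nat.zero_mod, Nat.zero_div, if_true, one_ne_zero, if_false, pow_zero,
          add_sub_cancel_right]
        field_simp
        rw [show Real.sqrt 2 ^ 2 = 2 by rw [sq, hsqrt]]
        ring
      · congr 3
        ring
  rw [h1, Fin.sum_univ_eq_sum_range
    (fun c : ℕ => if c ≤ m then G (-1) (m - c) else G 1 (c - m - 1)) (2 * m + 2),
    show 2 * m + 2 = (m + 1) + (m + 1) by ring, Finset.sum_range_add]
  have h2 : ∑ c ∈ Finset.range (m + 1), (if c ≤ m then G (-1) (m - c) else G 1 (c - m - 1))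
      = ∑ j ∈ Finset.range (m + 1), G (-1) j := by
    rw [← Finset.sum_range_reflect]
    apply Finset.sum_congr rfl
    intro c hc
    have := Finset.mem_range.mp hc
    rw [if_pos (by omega)]
    congr 1
    omega
  have h3 : ∑ c ∈ Finset.range (m + 1),
      (if m + 1 + c ≤ m then G (-1) (m - (m + 1 + c)) else G 1 (m + 1 + c - m - 1))
      = ∑ j ∈ Finset.range (m + 1), G 1 j := by
    apply Finset.sum_congr rfl
    intro c hc
    rw [if_neg (by omega)]
    congr 1
    omega
  rw [h2, h3, ← Finset.sum_add_distrib, Complex.ofReal_sum, Finset.mul_sum]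
  apply Finset.sum_congr rfl
  intro j hj
  have hj' : j ≤ m := by have := Finset.mem_range.mp hj; omega
  have hPj : P j = _ := hahn_prod j m α hα hj'
  simp only [hG]
  rw [hPj]
  generalize poch (α + 1) (m + 1) / poch (2 * α + 2) (m + 1) = A
  generalize poch (-(m : ℝ)) j * poch (2 * α + 2) j
                  / ((j.factorial : ℝ) * poch (2 * α + m + 3) j) = B
  have s1 : Complex.exp (-Complex.I * t * ((-1 * (2 * (α + j + 1)) : ℝ) : ℂ))
      = Complex.cos ((2 * t * (α + j + 1) : ℝ) : ℂ)
        + Complex.sin ((2 * t * (α + j + 1) : ℝ) : ℂ) * Complex.I := by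
    rw [← Complex.exp_mul_I]
    congr 1
    push_cast
    ring
  have s2 : Complex.exp (-Complex.I * t * ((1 * (2 * (α + j + 1)) : ℝ) : ℂ))
      = Complex.cos ((2 * t * (α + j + 1) : ℝ) : ℂ)
        - Complex.sin ((2 * t * (α + j + 1) : ℝ) : ℂ) * Complex.I := by
    have := Complex.exp_mul_I (-((2 * t * (α + j + 1) : ℝ) : ℂ))
    rw [Complex.cos_neg, Complex.sin_neg, neg_mul (Complex.sin _), ← sub_eq_add_neg] at this
    rw [← this]
    congr 1
    push_cast
    ring
  rw [s1, s2, Complex.ofReal_mul B, Complex.ofReal_sin]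
  push_cast
  ring
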